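/- (Gessel–Lucas congruence for the Almkvist–Zudilin numbers.) Let A_\delta(n) = \sum_{k=0}^{\lfloor n/3 \rfloor} (-1)^k 3^{n-3k} \binom{n}{3k} \binom{n+k}{n} (3k)!/(k!)^3, and let A_\delta' : \mathbb{Z}_{\ge 0} \to \mathbb{Q} be any sequence with A_\delta'(0) = 0 satisfying, for all n \ge 1, the recurrence (n+1)^3 A_\delta'(n+1) = (2n+1)(7 n^2 + 7 n + 3) A_\delta'(n) - 81 n^3 A_\delta'(n-1) - 3 (n+1)^2 A_\delta(n+1) + (42 n^2 + 42 n + 13) A_\delta(n) - 243 n^2 A_\delta(n-1), together with A_\delta'(1) = 3 A_\delta'(0) - 3 A_\delta(1) + 13 A_\delta(0) (the case n = 0, where the terms with index -1 are absent). Then for every prime p \ge 3 and all integers n \ge 0 and k with 0 \le k < p, the rational number A_\delta(p n + k) - A_\delta(k) A_\delta(n) - p n A_\delta'(k) A_\delta(n) has p-adic valuation at least 2; that is, A_\delta(p n + k) \equiv A_\delta(k) A_\delta(n) + p n A_\delta'(k) A_\delta(n) (mod p^2) in the p-adic sense. -/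

import Mathlib

/-- The Almkvist–Zudilin numbers (as rationals). -/
def aperyDelta (n : ℕ) : ℚ :=
  ∑ k ∈ Finset.range (n / 3 + 1),
    (-1) ^ k * 3 ^ (n - 3 * k) * (n.choose (3 * k) : ℚ) * ((n + k).choose n : ℚ) *
      (((3 * k).factorial / k.factorial ^ 3 : ℕ) : ℚ)

/-- The multinomial coefficient `(3k)! / k!³`. -/
def trinomial (k : ℕ) : ℕ := (3 * k).choose k * (2 * k).choose k

theorem trinomial_mul_factorial (k : ℕ) :
    trinomial k * k.factorial ^ 3 = (3 * k).factorial := by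
  have h₁ := Nat.add_choose_mul_factorial_mul_factorial k k
  have h₂ := Nat.add_choose_mul_factorial_mul_factorial (2 * k) k
  rw [show k + k = 2 * k by ring] at h₁
  rw [show 2 * k + k = 3 * k by ring, ← h₁] at h₂
  rw [trinomial, ← h₂]
  ring

/-- The `k`-th summand of the `n`-th Almkvist–Zudilin number. -/
def deltaTerm (n k : ℕ) : ℤ :=
  (-1) ^ k * 3 ^ (n - 3 * k) * n.choose (3 * k) * (n + k).choose n * trinomial k

theorem deltaTerm_eq_zero {n k : ℕ} (h : n < 3 * k) : deltaTerm n k = 0 := by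
  simp [deltaTerm, Nat.choose_eq_zero_of_lt h]

/-- The Almkvist–Zudilin numbers as integers. -/
def deltaInt (n : ℕ) : ℤ := ∑ k ∈ Finset.range (n / 3 + 1), deltaTerm n k

theorem deltaInt_eq_sum {n M : ℕ} (h : n < 3 * M) :
    deltaInt n = ∑ k ∈ Finset.range M, deltaTerm n k := by
  refine Finset.sum_subset (fun k hk => ?_) (fun k _ hk => deltaTerm_eq_zero ?_)
  · rw [Finset.mem_range] at hk ⊢
    omega
  · rw [Finset.mem_range] at hk
    omega

theorem aperyDelta_eq_deltaInt (n : ℕ) : aperyDelta n = deltaInt n := by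
  rw [aperyDelta, deltaInt, Int.cast_sum]
  refine Finset.sum_congr rfl fun k _ => ?_
  rw [← trinomial_mul_factorial, Nat.mul_div_cancel _ (pow_pos k.factorial_pos 3), deltaTerm]
  push_cast
  rfl

/-- The reciprocal of the factorial, extended by zero to the negative integers. -/
def invFactorial (z : ℤ) : ℚ := if z < 0 then 0 else (z.toNat.factorial : ℚ)⁻¹

theorem invFactorial_of_neg {z : ℤ} (h : z < 0) : invFactorial z = 0 := if_pos h

theorem invFactorial_natCast (n : ℕ) : invFactorial n = (n.factorial : ℚ)⁻¹ := by
  simp [invFactorial]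

theorem invFactorial_sub_one (z : ℤ) : invFactorial (z - 1) = z * invFactorial z := by
  rcases lt_trichotomy z 0 with h | rfl | h
  · rw [invFactorial_of_neg h, invFactorial_of_neg (by omega), mul_zero]
  · simp [invFactorial]
  · obtain ⟨n, rfl⟩ : ∃ n : ℕ, z = n + 1 := ⟨(z - 1).toNat, by omega⟩
    rw [add_sub_cancel_right, invFactorial_natCast]
    rw [show ((n : ℤ) + 1) = ((n + 1 : ℕ) : ℤ) by push_cast; ring, invFactorial_natCast,
      Nat.factorial_succ]
    have := n.factorial_ne_zero
    push_cast
    field_simp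

theorem deltaTerm_eq_factorial (n k : ℕ) :
    (deltaTerm n k : ℚ) = (-1) ^ k * 3 ^ n / 27 ^ k * (n + k).factorial / k.factorial ^ 4 *
      invFactorial (n - 3 * k) := by
  rcases lt_or_ge n (3 * k) with h | h
  · rw [deltaTerm_eq_zero h, invFactorial_of_neg (by omega)]
    simp
  · obtain ⟨d, rfl⟩ := Nat.exists_eq_add_of_le h
    have h₁ := Nat.add_choose_mul_factorial_mul_factorial d (3 * k)
    rw [add_comm d] at h₁
    have h₃ := (Nat.cast_inj (R := ℚ)).2 h₁
    rw [← trinomial_mul_factorial] at h₃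
    have h₄ := Nat.add_choose_mul_factorial_mul_factorial k (3 * k + d)
    rw [add_comm k] at h₄
    replace h₄ := (Nat.cast_inj (R := ℚ)).2 h₄
    push_cast at h₃ h₄
    rw [show ((3 * k + d : ℕ) : ℤ) - 3 * k = d by push_cast; ring, invFactorial_natCast, deltaTerm,
      Nat.add_sub_cancel_left, ← h₄, ← h₃]
    have := k.factorial_ne_zero
    have := d.factorial_ne_zero
    push_cast
    rw [pow_add, pow_mul]
    field_simp
    norm_num

theorem deltaInt_recurrence (n : ℕ) :
    ((n : ℤ) + 1) ^ 3 * deltaInt (n + 1) =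
      (2 * n + 1) * (7 * n ^ 2 + 7 * n + 3) * deltaInt n - 81 * n ^ 3 * deltaInt (n - 1) := by
  rcases n with _ | n
  · decide
  have key (k : ℕ) : ((n : ℚ) + 2) ^ 3 * deltaTerm (n + 2) k -
      (2 * n + 3) * (7 * (n + 1) ^ 2 + 7 * (n + 1) + 3) * deltaTerm (n + 1) k +
      81 * (n + 1) ^ 3 * deltaTerm n k =
      (fun k : ℕ => -324 * (4 * (n : ℚ) + 5) * (-1) ^ k * 3 ^ n / 27 ^ k * (n + k).factorial *
        k ^ 4 / k.factorial ^ 4 * invFactorial (n + 2 - 3 * k)) (k + 1) -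
      (fun k : ℕ => -324 * (4 * (n : ℚ) + 5) * (-1) ^ k * 3 ^ n / 27 ^ k * (n + k).factorial *
        k ^ 4 / k.factorial ^ 4 * invFactorial (n + 2 - 3 * k)) k := by
    have e₁ := invFactorial_sub_one (n + 2 - 3 * k)
    have e₂ := invFactorial_sub_one (n + 2 - 3 * k - 1)
    have e₃ := invFactorial_sub_one (n + 2 - 3 * k - 1 - 1)
    rw [e₁] at e₂
    rw [e₂] at e₃
    simp only [deltaTerm_eq_factorial]
    rw [show ((n + 2 : ℕ) : ℤ) - 3 * k = n + 2 - 3 * k by push_cast; ring,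
      show ((n + 1 : ℕ) : ℤ) - 3 * k = n + 2 - 3 * k - 1 by push_cast; ring,
      show (n : ℤ) - 3 * k = n + 2 - 3 * k - 1 - 1 by ring,
      show (n : ℤ) + 2 - 3 * (k + 1 : ℕ) = n + 2 - 3 * k - 1 - 1 - 1 by push_cast; ring,
      e₃, e₂, e₁, show n + 2 + k = n + k + 1 + 1 by ring, show n + 1 + k = n + k + 1 by ring,
      show n + (k + 1) = n + k + 1 by ring]
    simp only [Nat.factorial_succ]
    have := k.factorial_ne_zero
    push_cast
    field_simp
    ring
  have hsum := Finset.sum_range_sub (fun k : ℕ => -324 * (4 * (n : ℚ) + 5) * (-1) ^ k * 3 ^ n /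
    27 ^ k * (n + k).factorial * k ^ 4 / k.factorial ^ 4 * invFactorial (n + 2 - 3 * k)) (n + 3)
  rw [← Finset.sum_congr rfl fun k _ => key k, invFactorial_of_neg (by push_cast; omega)] at hsum
  simp only [Finset.sum_add_distrib, Finset.sum_sub_distrib, ← Finset.mul_sum, ← Int.cast_sum] at hsum
  rw [← deltaInt_eq_sum (by omega), ← deltaInt_eq_sum (by omega), ← deltaInt_eq_sum (by omega)]
    at hsum
  rw [Nat.add_sub_cancel]
  have : (((n + 1 : ℕ) + 1 : ℤ) : ℚ) ^ 3 * deltaInt (n + 1 + 1) =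
      (2 * (n + 1 : ℕ) + 1) * (7 * (n + 1 : ℕ) ^ 2 + 7 * (n + 1 : ℕ) + 3) * deltaInt (n + 1) -
        81 * (n + 1 : ℕ) ^ 3 * deltaInt n := by
    push_cast
    rw [Nat.cast_zero] at hsum
    linear_combination hsum
  exact_mod_cast this

theorem natCast_choose_eq_lucas (p : ℕ) [Fact p.Prime] (a b i j : ℕ) (hi : i < p) (hj : j < p) :
    ((p * a + i).choose (p * b + j) : ZMod p) = i.choose j * a.choose b := by
  have h := (ZMod.natCast_eq_natCast_iff _ _ p).2
    (Choose.choose_modEq_choose_mod_mul_choose_div_nat (p := p) (n := p * a + i) (k := p * b + j))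
  have hp : 0 < p := by omega
  rwa [Nat.mul_add_mod, Nat.mul_add_mod, Nat.mod_eq_of_lt hi, Nat.mod_eq_of_lt hj,
    Nat.mul_add_div hp, Nat.mul_add_div hp, Nat.div_eq_of_lt hi, Nat.div_eq_of_lt hj, add_zero,
    add_zero, Nat.cast_mul] at h

theorem dvd_choose_mul_of_not_dvd {p : ℕ} (hp : p.Prime) (a : ℕ) {i : ℕ} (hi : ¬p ∣ i) :
    p ∣ (p * a).choose i := by
  have := Fact.mk hp
  rw [← ZMod.natCast_eq_zero_iff, ← Nat.div_add_mod i p, ← add_zero (p * a),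
    natCast_choose_eq_lucas p _ _ _ _ hp.pos (Nat.mod_lt _ hp.pos), Nat.choose_eq_zero_of_lt]
  · simp
  · exact Nat.pos_of_ne_zero fun h => hi (Nat.dvd_of_mod_eq_zero h)

/-- A congruence of Babbage type, modulo the square of an arbitrary prime. -/
theorem choose_mul_mul_eq_choose {p : ℕ} (hp : p.Prime) (a b : ℕ) :
    ((p * a).choose (p * b) : ZMod (p ^ 2)) = a.choose b := by
  induction a generalizing b with
  | zero =>
    rcases b with _ | b
    · simp
    · rw [mul_zero, Nat.choose_eq_zero_of_lt (Nat.mul_pos hp.pos b.succ_pos)]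
      simp
  | succ a ih =>
    rcases b with _ | b
    · simp
    rw [mul_add, mul_one, Nat.add_choose_eq, Nat.cast_sum, Finset.sum_eq_add (p * (b + 1), 0)
      (p * b, p), Nat.choose_succ_succ, Nat.cast_mul, Nat.cast_mul, ih, ih]
    · simp [add_comm]
    · intro h
      exact hp.ne_zero (Prod.ext_iff.1 h).2.symm
    · rintro ⟨i, j⟩ hij ⟨h₁, h₂⟩
      rw [Finset.HasAntidiagonal.mem_antidiagonal] at hij
      simp only [ne_eq, Prod.mk.injEq, not_and] at hij h₁ h₂
      rw [ZMod.natCast_eq_zero_iff, sq]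
      rcases lt_trichotomy j p with hj | rfl | hj
      · have hj0 : j ≠ 0 := by
          rintro rfl
          exact h₁ (by simpa using hij) rfl
        have hi : ¬p ∣ i := fun h => by
          have : p ∣ j := (Nat.dvd_add_right h).1 (hij ▸ dvd_mul_right _ _)
          exact absurd (Nat.le_of_dvd (Nat.pos_of_ne_zero hj0) this) (by omega)
        exact mul_dvd_mul (dvd_choose_mul_of_not_dvd hp a hi) (hp.dvd_choose_self hj0 hj)
      · exact absurd rfl (h₂ (by rw [mul_add, mul_one] at hij; omega))
      · rw [Nat.choose_eq_zero_of_lt hj, mul_zero]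
        exact dvd_zero _
    · intro h
      exact absurd (Finset.HasAntidiagonal.mem_antidiagonal.2 (by simp)) h
    · intro h
      exact absurd (Finset.HasAntidiagonal.mem_antidiagonal.2 (by ring)) h

theorem trinomial_mul_eq {p : ℕ} (hp : p.Prime) (k : ℕ) :
    (trinomial (p * k) : ZMod (p ^ 2)) = trinomial k := by
  rw [trinomial, trinomial, Nat.cast_mul, Nat.cast_mul, mul_left_comm 3, mul_left_comm 2,
    choose_mul_mul_eq_choose hp, choose_mul_mul_eq_choose hp]

theorem exists_prod_add_mul_eq (p : ℕ) [Fact p.Prime] {ι : Type*} (s : Finset ι) (a b : ι → ℤ)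
    (ha : ∀ i ∈ s, (a i : ZMod p) ≠ 0) :
    ∃ c : ℤ, ∏ i ∈ s, (a i + p * b i) = ∏ i ∈ s, a i + p * c ∧
      (c : ZMod p) = (∏ i ∈ s, (a i : ZMod p)) * ∑ i ∈ s, (b i : ZMod p) / a i := by
  classical
  induction s using Finset.induction_on with
  | empty => exact ⟨0, by simp⟩
  | insert i s hi ih =>
    obtain ⟨c, hc, hc'⟩ := ih fun j hj => ha j (Finset.mem_insert_of_mem hj)
    refine ⟨a i * c + b i * ∏ j ∈ s, a j + p * (b i * c), ?_, ?_⟩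
    · rw [Finset.prod_insert hi, Finset.prod_insert hi, hc]
      ring
    · have := ha i (Finset.mem_insert_self i s)
      rw [Finset.prod_insert hi, Finset.sum_insert hi]
      push_cast
      rw [hc', CharP.cast_eq_zero]
      field_simp
      ring

theorem image_three_mul_mod {p : ℕ} (hp : p.Prime) (hp3 : 3 < p) :
    (Finset.Ioo 0 p).image (fun r => 3 * r % p) = Finset.Ioo 0 p := by
  have hcop : Nat.Coprime p 3 := (Nat.coprime_primes hp Nat.prime_three).2 (by omega)
  have hinj : Set.InjOn (fun r => 3 * r % p) (Finset.Ioo 0 p : Finset ℕ) := by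
    intro x hx y hy hxy
    rw [Finset.mem_coe, Finset.mem_Ioo] at hx hy
    have h : x ≡ y [MOD p] := Nat.ModEq.cancel_left_of_coprime hcop hxy
    rwa [Nat.ModEq, Nat.mod_eq_of_lt hx.2, Nat.mod_eq_of_lt hy.2] at h
  refine Finset.eq_of_subset_of_card_le (fun x hx => ?_) (Finset.card_image_of_injOn hinj).ge
  obtain ⟨r, hr, rfl⟩ := Finset.mem_image.1 hx
  rw [Finset.mem_Ioo] at hr ⊢
  refine ⟨Nat.pos_of_ne_zero fun h => ?_, Nat.mod_lt _ hp.pos⟩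
  have := Nat.le_of_dvd hr.1 (hcop.dvd_of_dvd_mul_left (Nat.dvd_of_mod_eq_zero h))
  omega

theorem natCast_ne_zero_of_lt {p i : ℕ} (h₀ : 0 < i) (h : i < p) : (i : ZMod p) ≠ 0 := by
  rw [Ne, ZMod.natCast_eq_zero_iff]
  exact Nat.not_dvd_of_pos_of_lt h₀ h

theorem three_ne_zero_zmod {p : ℕ} (hp3 : 3 < p) : (3 : ZMod p) ≠ 0 := by
  exact_mod_cast natCast_ne_zero_of_lt (p := p) three_pos hp3

theorem sum_reflect_Ioo {M : Type*} [AddCommMonoid M] (p : ℕ) (f : ℕ → M) :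
    ∑ r ∈ Finset.Ioo 0 p, f (p - r) = ∑ r ∈ Finset.Ioo 0 p, f r := by
  refine Finset.sum_nbij' (fun r => p - r) (fun r => p - r) ?_ ?_ ?_ ?_ ?_ <;>
    intro r hr <;> rw [Finset.mem_Ioo] at hr
  · rw [Finset.mem_Ioo]; omega
  · rw [Finset.mem_Ioo]; omega
  · omega
  · omega

theorem sum_inv_Ioo_eq_zero {p : ℕ} [Fact p.Prime] (hp2 : 2 < p) :
    ∑ r ∈ Finset.Ioo 0 p, (r : ZMod p)⁻¹ = 0 := by
  have h : ∑ r ∈ Finset.Ioo 0 p, (r : ZMod p)⁻¹ = -∑ r ∈ Finset.Ioo 0 p, (r : ZMod p)⁻¹ := by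
    conv_lhs => rw [← sum_reflect_Ioo]
    rw [← Finset.sum_neg_distrib]
    refine Finset.sum_congr rfl fun r hr => ?_
    rw [Finset.mem_Ioo] at hr
    rw [Nat.cast_sub hr.2.le, CharP.cast_eq_zero, zero_sub, inv_neg]
  have h2 : (2 : ZMod p) ≠ 0 := by exact_mod_cast natCast_ne_zero_of_lt (p := p) two_pos hp2
  refine (mul_eq_zero.1 (?_ : (2 : ZMod p) * _ = 0)).resolve_left h2
  linear_combination h

theorem sum_floor_div_eq {p : ℕ} [Fact p.Prime] (hp3 : 3 < p) :
    ∑ r ∈ Finset.Ioo 0 p, ((3 * r / p : ℕ) : ZMod p) / r =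
      -2 * ∑ r ∈ Finset.Ioo 0 p with 3 * r < p, (r : ZMod p)⁻¹ := by
  have hp := Fact.out (p := p.Prime)
  have h : ∀ r ∈ Finset.Ioo 0 p, ((3 * r / p : ℕ) : ZMod p) / r =
      (r : ZMod p)⁻¹ - (if 3 * r < p then (r : ZMod p)⁻¹ else 0) -
        (if 3 * (p - r) < p then ((p - r : ℕ) : ZMod p)⁻¹ else 0) := by
    intro r hr
    rw [Finset.mem_Ioo] at hr
    have hne : 3 * (p - r) ≠ p := fun h => by
      have := (Nat.prime_dvd_prime_iff_eq Nat.prime_three hp).1 ⟨_, h.symm⟩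
      omega
    rw [Nat.cast_sub hr.2.le, CharP.cast_eq_zero (ZMod p) p, zero_sub, inv_neg]
    rcases lt_or_ge (3 * r) p with h | h
    · rw [if_pos h, if_neg (by omega), Nat.div_eq_of_lt h]
      simp
    rcases lt_or_ge (3 * (p - r)) p with h' | h'
    · rw [if_neg (by omega), if_pos h',
        show 3 * r / p = 2 from Nat.div_eq_of_lt_le (by omega) (by omega)]
      push_cast
      ring
    · rw [if_neg (by omega), if_neg (by omega),
        show 3 * r / p = 1 from Nat.div_eq_of_lt_le (by omega) (by omega)]
      push_cast
      ring
  rw [Finset.sum_congr rfl h, Finset.sum_sub_distrib, Finset.sum_sub_distrib,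
    sum_reflect_Ioo p fun r => if 3 * r < p then (r : ZMod p)⁻¹ else 0,
    sum_inv_Ioo_eq_zero (by omega), Finset.sum_filter]
  ring

/-- The Fermat quotient of `3` modulo `p` as a harmonic sum. -/
theorem exists_three_pow_eq {p : ℕ} [Fact p.Prime] (hp3 : 3 < p) :
    ∃ q : ℤ, (3 : ℤ) ^ p = 3 + p * q ∧
      (q : ZMod p) = -2 * ∑ r ∈ Finset.Ioo 0 p with 3 * r < p, (r : ZMod p)⁻¹ := by
  have hp := Fact.out (p := p.Prime)
  have h3 := three_ne_zero_zmod hp3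
  have hr : ∀ r ∈ Finset.Ioo 0 p, (r : ZMod p) ≠ 0 := fun r hr =>
    natCast_ne_zero_of_lt (Finset.mem_Ioo.1 hr).1 (Finset.mem_Ioo.1 hr).2
  obtain ⟨c, hc, hc'⟩ := exists_prod_add_mul_eq p (Finset.Ioo 0 p) (fun r => 3 * (r : ℤ))
    (fun r => -((3 * r / p : ℕ) : ℤ)) (fun r h => by
      push_cast
      exact mul_ne_zero h3 (hr r h))
  have hfermat : (p : ℤ) ∣ 3 ^ p - 3 := by
    rw [← ZMod.intCast_zmod_eq_zero_iff_dvd]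
    push_cast
    rw [ZMod.pow_card, sub_self]
  obtain ⟨q, hq⟩ := hfermat
  refine ⟨q, by linear_combination hq, ?_⟩
  have hperm : ∏ r ∈ Finset.Ioo 0 p, (3 * (r : ℤ) + p * -((3 * r / p : ℕ) : ℤ)) =
      ∏ r ∈ Finset.Ioo 0 p, (r : ℤ) := by
    have hcop : Nat.Coprime p 3 := (Nat.coprime_primes hp Nat.prime_three).2 (by omega)
    conv_rhs => rw [← image_three_mul_mod hp hp3]
    rw [Finset.prod_image]
    · refine Finset.prod_congr rfl fun r _ => ?_
      have := Nat.div_add_mod (3 * r) p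
      zify at this ⊢
      linear_combination -this
    · exact Finset.injOn_of_card_image_eq (by rw [image_three_mul_mod hp hp3])
  rw [hperm, Finset.prod_mul_distrib, Finset.prod_const, Nat.card_Ioo] at hc
  set F : ℤ := ∏ r ∈ Finset.Ioo 0 p, (r : ℤ) with hF
  have hF0 : (F : ZMod p) ≠ 0 := by
    rw [hF]
    push_cast
    exact Finset.prod_ne_zero_iff.2 hr
  have hpow : (3 : ℤ) ^ p = 3 * 3 ^ (p - 0 - 1) := by
    rw [← pow_succ']
    congr 1
    omega
  have hint : F * q = -3 * c := by
    have hp0 : (p : ℤ) ≠ 0 := by exact_mod_cast hp.ne_zero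
    apply mul_left_cancel₀ hp0
    linear_combination -F * hq + F * hpow - 3 * hc
  have hmod := congrArg (Int.cast : ℤ → ZMod p) hint
  have hsum := sum_floor_div_eq hp3
  have h31 : (3 : ZMod p) ^ (p - 1) = 1 := ZMod.pow_card_sub_one_eq_one h3
  simp only [Int.cast_mul, Int.cast_neg, Int.cast_natCast, Int.cast_ofNat,
    Finset.prod_mul_distrib] at hc' hmod
  rw [hc', Finset.prod_const, Nat.card_Ioo, Nat.sub_zero, h31, one_mul] at hmod
  have hFc : (F : ZMod p) = ∏ r ∈ Finset.Ioo 0 p, (r : ZMod p) := by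
    rw [hF]
    push_cast
    rfl
  rw [← hFc] at hmod
  rw [← hsum]
  apply mul_left_cancel₀ hF0
  rw [hmod]
  have : ∀ r ∈ Finset.Ioo 0 p, -((3 * r / p : ℕ) : ZMod p) / (3 * r) =
      -1 / 3 * (((3 * r / p : ℕ) : ZMod p) / r) := by
    intro r h
    have := hr r h
    field_simp
  rw [Finset.sum_congr rfl this, ← Finset.mul_sum]
  field_simp

theorem natCast_choose_succ_mul {R : Type*} [CommRing R] (n k : ℕ) :
    (n.choose (k + 1) : R) * (k + 1) = n.choose k * (n - k) := by
  rcases le_or_gt k n with h | h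
  · have := congrArg (Nat.cast : ℕ → R) (Nat.choose_succ_right_eq n k)
    push_cast [Nat.cast_sub h] at this
    exact this
  · rw [Nat.choose_eq_zero_of_lt h, Nat.choose_eq_zero_of_lt (by omega)]
    simp

theorem natCast_choose_mul_succ {R : Type*} [CommRing R] (n k : ℕ) :
    (n.choose k : R) * (n + 1) = (n + 1).choose k * (n + 1 - k) := by
  rcases le_or_gt k (n + 1) with h | h
  · have := congrArg (Nat.cast : ℕ → R) (Nat.choose_mul_succ_eq n k)
    push_cast [Nat.cast_sub h] at this
    exact this
  · rw [Nat.choose_eq_zero_of_lt h, Nat.choose_eq_zero_of_lt (by omega)]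
    simp

theorem sum_range_alternating_choose_mul_choose (l M : ℕ) :
    ∑ i ∈ Finset.range (M + 1), (-1 : ℤ) ^ i * (l + 1).choose i * (l + i).choose i =
      (-1) ^ M * l.choose M * (l + 1 + M).choose M := by
  induction M with
  | zero => simp
  | succ M ih =>
    rw [Finset.sum_range_succ, ih, show l + 1 + (M + 1) = l + M + 1 + 1 by ring,
      Nat.choose_succ_succ l M, Nat.choose_succ_succ (l + M + 1) M,
      show l + 1 + M = l + M + 1 by ring, show l + (M + 1) = l + M + 1 by ring]
    have h₁ := natCast_choose_succ_mul (R := ℤ) (l + M + 1) M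
    have h₂ := natCast_choose_succ_mul (R := ℤ) l M
    have hM : ((M : ℤ) + 1) ≠ 0 := by positivity
    apply mul_left_cancel₀ hM
    push_cast at h₁ h₂ ⊢
    rw [pow_succ]
    linear_combination (-1) ^ M * ((l + M + 1).choose M : ℤ) * h₂ - (-1) ^ M * (l.choose M : ℤ) * h₁

theorem sum_alternating_choose_mul_choose_div {K : Type*} [Field K] (m : ℕ)
    (hm : ∀ i : ℕ, 0 < i → i ≤ m → (i : K) ≠ 0) :
    ∑ i ∈ Finset.Ico 1 (m + 1), (-1 : K) ^ i * m.choose i * (m + i).choose i / i =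
      -2 * ∑ i ∈ Finset.Ico 1 (m + 1), (i : K)⁻¹ := by
  induction m with
  | zero => simp
  | succ l ih =>
    have hl : ((l : K) + 1) ≠ 0 := by exact_mod_cast hm (l + 1) l.succ_pos le_rfl
    have hstep : ∀ i ∈ Finset.Ico 1 (l + 1 + 1),
        (-1 : K) ^ i * (l + 1).choose i * (l + 1 + i).choose i / i =
          (-1 : K) ^ i * l.choose i * (l + i).choose i / i +
            2 / (l + 1) * ((-1 : K) ^ i * (l + 1).choose i * (l + i).choose i) := by
      intro i hi
      rw [Finset.mem_Ico] at hi
      have hi0 : (i : K) ≠ 0 := hm i (by omega) (by omega)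
      have h₁ := natCast_choose_mul_succ (R := K) l i
      have h₂ := natCast_choose_mul_succ (R := K) (l + i) i
      rw [show l + i + 1 = l + 1 + i by ring] at h₂
      push_cast at h₂
      field_simp
      linear_combination -((l + 1).choose i : K) * h₂ - ((l + i).choose i : K) * h₁
    have hzero := sum_range_alternating_choose_mul_choose l (l + 1)
    rw [Nat.choose_succ_self, Finset.range_eq_Ico, Finset.sum_eq_sum_Ico_succ_bot (by omega)] at hzero
    have hzero' := congrArg (Int.cast : ℤ → K) hzero
    simp only [pow_zero, Nat.choose_zero_right, Nat.cast_one, mul_one, zero_add, Nat.cast_zero,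
      mul_zero, zero_mul, Int.cast_add, Int.cast_one, Int.cast_zero, Int.cast_sum, Int.cast_mul,
      Int.cast_pow, Int.cast_neg, Int.cast_natCast] at hzero'
    rw [Finset.sum_congr rfl hstep, Finset.sum_add_distrib, ← Finset.mul_sum,
      eq_neg_of_add_eq_zero_right hzero', Finset.sum_Ico_succ_top (by omega),
      ih fun i h h' => hm i h (by omega), Finset.sum_Ico_succ_top (b := l + 1) (by omega),
      Nat.choose_succ_self]
    push_cast
    field_simp
    ring

theorem trinomial_succ_mul (i : ℕ) :
    trinomial (i + 1) * (i + 1) ^ 2 = 3 * (3 * i + 1) * (3 * i + 2) * trinomial i := by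
  have h₁ := trinomial_mul_factorial (i + 1)
  rw [mul_add, mul_one, Nat.factorial_succ, Nat.factorial_succ, Nat.factorial_succ, Nat.factorial_succ,
    ← trinomial_mul_factorial] at h₁
  have : (i + 1) * i.factorial ^ 3 ≠ 0 := by positivity
  apply mul_right_cancel₀ this
  linear_combination h₁

theorem natCast_trinomial_eq {p : ℕ} [Fact p.Prime] (m : ℕ) (hm : (9 * m * (m + 1) : ZMod p) = -2)
    {i : ℕ} (hi : i < p) :
    (trinomial i : ZMod p) = (-27) ^ i * m.choose i * (m + i).choose i := by
  induction i with
  | zero => simp [trinomial]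
  | succ i ih =>
    have h₀ := congrArg (Nat.cast : ℕ → ZMod p) (trinomial_succ_mul i)
    have h₁ := natCast_choose_succ_mul (R := ZMod p) m i
    have h₂ := natCast_choose_succ_mul (R := ZMod p) (m + i + 1) i
    have h₃ := natCast_choose_mul_succ (R := ZMod p) (m + i) i
    have hi0 : ((i : ZMod p) + 1) ≠ 0 := by exact_mod_cast natCast_ne_zero_of_lt i.succ_pos hi
    rw [← add_assoc]
    push_cast at h₀ h₂ h₃
    rw [ih (by omega)] at h₀
    apply mul_right_cancel₀ (pow_ne_zero 2 hi0)
    rw [h₀, pow_succ]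
    have h₄ : ((m + i + 1).choose (i + 1) : ZMod p) * (i + 1) = (m + i).choose i * (m + i + 1) := by
      rw [h₂, h₃]
    linear_combination 27 * (-27 : ZMod p) ^ i * (m.choose i * (m - i)) * h₄ +
      27 * (-27 : ZMod p) ^ i * ((m + i + 1).choose (i + 1) : ZMod p) * (i + 1) * h₁ +
      3 * (-27 : ZMod p) ^ i * m.choose i * (m + i).choose i * hm

/-- The Fermat quotient of `3` modulo `p` as a sum of trinomial coefficients. -/
theorem exists_three_pow_eq_sum_trinomial {p : ℕ} [Fact p.Prime] (hp3 : 3 < p) :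
    ∃ q : ℤ, (3 : ℤ) ^ p = 3 + p * q ∧
      (q : ZMod p) = ∑ i ∈ Finset.Ico 1 p with 3 * i < p, (trinomial i : ZMod p) / (i * 27 ^ i) := by
  have hp := Fact.out (p := p.Prime)
  have h3 := three_ne_zero_zmod hp3
  obtain ⟨q, hq, hq'⟩ := exists_three_pow_eq hp3
  refine ⟨q, hq, ?_⟩
  have hmod : p % 3 ≠ 0 := fun h => by
    have := (Nat.prime_dvd_prime_iff_eq Nat.prime_three hp).1 (Nat.dvd_of_mod_eq_zero h)
    omega
  have hset : (Finset.Ico 1 p).filter (fun i => 3 * i < p) = Finset.Ico 1 (p / 3 + 1) := by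
    ext i
    simp only [Finset.mem_filter, Finset.mem_Ico]
    omega
  have hm : (9 * (p / 3 : ℕ) * ((p / 3 : ℕ) + 1) : ZMod p) = -2 := by
    have h := Nat.div_add_mod p 3
    have h' := congrArg (Nat.cast : ℕ → ZMod p) h
    rw [CharP.cast_eq_zero (ZMod p) p] at h'
    have h12 : p % 3 = 1 ∨ p % 3 = 2 := by omega
    rcases h12 with h12 | h12 <;> rw [h12] at h' <;> push_cast at h'
    · linear_combination (3 * ((p / 3 : ℕ) : ZMod p) + 2) * h'
    · linear_combination (3 * ((p / 3 : ℕ) : ZMod p) + 1) * h'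
  rw [hq', show Finset.Ioo 0 p = Finset.Ico 1 p from rfl, hset,
    ← sum_alternating_choose_mul_choose_div (p / 3)
      (fun i h h' => natCast_ne_zero_of_lt h (by omega))]
  refine Finset.sum_congr rfl fun i hi => ?_
  rw [Finset.mem_Ico] at hi
  have hi0 : (i : ZMod p) ≠ 0 := natCast_ne_zero_of_lt (by omega) (by omega)
  have h27 : (27 : ZMod p) ≠ 0 := by
    rw [show (27 : ZMod p) = 3 ^ 3 by norm_num]
    exact pow_ne_zero 3 h3
  rw [natCast_trinomial_eq _ hm (by omega), show (-27 : ZMod p) = -1 * 27 by ring, mul_pow]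
  field_simp

theorem choose_sub_one_eq_neg_one_pow {p : ℕ} [Fact p.Prime] {r : ℕ} (hr : r < p) :
    ((p - 1).choose r : ZMod p) = (-1) ^ r := by
  have hp := Fact.out (p := p.Prime)
  induction r with
  | zero => simp
  | succ r ih =>
    have h := congrArg (Nat.cast : ℕ → ZMod p) (Nat.choose_succ_succ (p - 1) r)
    rw [Nat.succ_eq_add_one, Nat.sub_add_cancel hp.one_le,
      (ZMod.natCast_eq_zero_iff _ _).2 (hp.dvd_choose_self r.succ_ne_zero hr)] at h
    push_cast at h
    rw [ih (by omega)] at h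
    rw [pow_succ]
    linear_combination -h

theorem trinomial_mul_add {p : ℕ} [Fact p.Prime] (j : ℕ) {i : ℕ} (hi : i < p) :
    (trinomial (p * j + i) : ZMod p) = if 3 * i < p then (trinomial j * trinomial i : ZMod p) else 0 := by
  rw [trinomial, show 3 * (p * j + i) = p * (3 * j) + 3 * i by ring,
    show 2 * (p * j + i) = p * (2 * j) + 2 * i by ring, Nat.cast_mul]
  split_ifs with h
  · rw [natCast_choose_eq_lucas p _ _ _ _ h hi, natCast_choose_eq_lucas p _ _ _ _ (by omega) hi,
      trinomial, trinomial]
    push_cast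
    ring
  rcases lt_or_ge (2 * i) p with h' | h'
  · rw [show p * (3 * j) + 3 * i = p * (3 * j + 1) + (3 * i - p) by
        rw [mul_add, mul_one, add_assoc, Nat.add_sub_cancel' (by omega)],
      natCast_choose_eq_lucas p _ _ _ _ (by omega) hi, Nat.choose_eq_zero_of_lt (by omega)]
    simp
  · rw [show p * (2 * j) + 2 * i = p * (2 * j + 1) + (2 * i - p) by
        rw [mul_add, mul_one, add_assoc, Nat.add_sub_cancel' h'],
      natCast_choose_eq_lucas p (2 * j + 1) _ _ _ (by omega) hi,
      Nat.choose_eq_zero_of_lt (by omega : 2 * i - p < i)]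
    simp

theorem exists_deltaTerm_mul_mul {p : ℕ} [Fact p.Prime] (hp2 : 2 < p) {q : ℤ}
    (hq : (3 : ℤ) ^ p = 3 + p * q) (n j : ℕ) :
    ∃ c : ℤ, (p : ℤ) ^ 2 ∣ deltaTerm (p * n) (p * j) - deltaTerm n j - p * c ∧
      (c * 3 : ZMod p) = (n - 3 * j : ℕ) * q * deltaTerm n j := by
  have hp := Fact.out (p := p.Prime)
  set d := n - 3 * j with hd
  obtain ⟨r, hr⟩ := Polynomial.powAddExpansion (3 : ℤ) (p * q) d
  set W : ℤ := (-1) ^ j * n.choose (3 * j) * (n + j).choose n * trinomial j with hW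
  have hT : deltaTerm n j = 3 ^ d * W := by
    rw [deltaTerm, hW]
    ring
  refine ⟨d * 3 ^ (d - 1) * q * W, ?_, ?_⟩
  · have h := (ZMod.intCast_zmod_eq_zero_iff_dvd
      (deltaTerm (p * n) (p * j) - (3 + p * q) ^ d * W) (p ^ 2)).1 (by
        rw [deltaTerm, hW, mul_left_comm 3 p j, ← Nat.mul_sub, ← mul_add, ← hq,
          pow_mul (-1 : ℤ), Odd.neg_one_pow (hp.odd_of_ne_two hp2.ne'), pow_mul 3]
        push_cast
        rw [choose_mul_mul_eq_choose hp, choose_mul_mul_eq_choose hp, trinomial_mul_eq hp]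
        ring)
    push_cast at h
    have h' := dvd_add h (Dvd.intro (q ^ 2 * r * W) rfl)
    have heq : deltaTerm (p * n) (p * j) - deltaTerm n j - p * (d * 3 ^ (d - 1) * q * W) =
        deltaTerm (p * n) (p * j) - (3 + p * q) ^ d * W + p ^ 2 * (q ^ 2 * r * W) := by
      rw [hr, hT]
      ring
    rwa [heq]
  · rw [hT]
    push_cast
    rcases d with _ | d
    · simp
    · rw [Nat.add_sub_cancel, pow_succ]
      ring

theorem exists_deltaTerm_mul_add {p : ℕ} [Fact p.Prime] (hp3 : 3 < p) {n j : ℕ} (hj : 3 * j ≤ n)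
    {i : ℕ} (hi : i ∈ Finset.Ico 1 p) :
    ∃ c : ℤ, deltaTerm (p * n) (p * j + i) = p * c ∧
      (c * 3 : ZMod p) = -(n - 3 * j : ℕ) * deltaTerm n j *
        if 3 * i < p then (trinomial i : ZMod p) / (i * 27 ^ i) else 0 := by
  have hp := Fact.out (p := p.Prime)
  rw [Finset.mem_Ico] at hi
  have h3 := three_ne_zero_zmod hp3
  have hi0 : (i : ZMod p) ≠ 0 := natCast_ne_zero_of_lt hi.1 hi.2
  rcases hj.eq_or_lt with rfl | hj'
  · refine ⟨0, ?_, by simp⟩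
    rw [deltaTerm_eq_zero (by rw [mul_left_comm, mul_add 3]; omega), mul_zero]
  obtain ⟨s, rfl⟩ : ∃ s, n = s + 1 := ⟨n - 1, by omega⟩
  set k := p * j + i with hk
  have hpk : ¬p ∣ 3 * k := by
    rw [← ZMod.natCast_eq_zero_iff, hk]
    push_cast
    rw [CharP.cast_eq_zero (ZMod p) p, zero_mul, zero_add]
    exact mul_ne_zero h3 hi0
  obtain ⟨e, he⟩ := dvd_choose_mul_of_not_dvd hp (s + 1) hpk
  refine ⟨(-1) ^ k * 3 ^ (p * (s + 1) - 3 * k) * e * (p * (s + 1) + k).choose (p * (s + 1)) *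
    trinomial k, ?_, ?_⟩
  · rw [deltaTerm, he]
    push_cast
    ring
  push_cast
  rw [hk, trinomial_mul_add j hi.2, ← hk]
  split_ifs with h
  swap
  · simp
  have hle : 3 * k ≤ p * (s + 1) := by
    have : p * (3 * j + 1) ≤ p * (s + 1) := Nat.mul_le_mul_left p hj'
    rw [hk]
    linarith
  have he' : (e : ZMod p) * (3 * i) = -(-1) ^ i * ((s + 1 : ℕ) - 3 * j : ℕ) * (s + 1).choose (3 * j) := by
    have h₁ := Nat.add_one_mul_choose_eq (p * s + (p - 1)) (p * (3 * j) + (3 * i - 1))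
    have hs : p * s + (p - 1) + 1 = p * (s + 1) := by
      rw [mul_add, mul_one, add_assoc, Nat.sub_add_cancel hp.one_le]
    have hk' : p * (3 * j) + (3 * i - 1) + 1 = 3 * k := by
      rw [add_assoc, Nat.sub_add_cancel (by omega), hk]
      ring
    rw [hs, hk', he, mul_assoc, mul_assoc] at h₁
    have h₂ := congrArg (Nat.cast : ℕ → ZMod p) (Nat.eq_of_mul_eq_mul_left hp.pos h₁)
    have h₃ := natCast_choose_mul_succ (R := ZMod p) s (3 * j)
    push_cast at h₂ h₃
    rw [natCast_choose_eq_lucas p _ _ _ _ (by have := hp.pos; omega) (by omega),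
      choose_sub_one_eq_neg_one_pow (by omega), hk] at h₂
    have hpow : -(-1 : ZMod p) ^ (3 * i - 1) = (-1) ^ i := by
      rw [← neg_one_mul, ← pow_succ', Nat.sub_add_cancel (by omega), pow_mul]
      norm_num
    rw [Nat.cast_sub hj, ← hpow]
    push_cast at h₂ ⊢
    rw [CharP.cast_eq_zero (ZMod p) p, zero_mul, zero_add] at h₂
    linear_combination -h₂ + (-1) ^ (3 * i - 1) * h₃
  have hpow3 : (3 : ZMod p) ^ (p * (s + 1) - 3 * k) * 27 ^ i = 3 ^ (s + 1 - 3 * j) := by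
    rw [show (27 : ZMod p) = 3 ^ 3 by norm_num, ← pow_mul, ← pow_add,
      show p * (s + 1) - 3 * k + 3 * i = p * (s + 1 - 3 * j) by
        have h₄ : 3 * k = p * (3 * j) + 3 * i := by rw [hk]; ring
        rw [Nat.mul_sub]
        omega, pow_mul, ZMod.pow_card]
  have hneg : (-1 : ZMod p) ^ k * (-1) ^ i = (-1) ^ j := by
    rw [hk, pow_add, pow_mul, Odd.neg_one_pow (hp.odd_of_ne_two (by omega)), mul_assoc, ← mul_pow]
    simp
  have hchoose : ((p * (s + 1) + k).choose (p * (s + 1)) : ZMod p) = (s + 1 + j).choose (s + 1) := by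
    rw [show p * (s + 1) + k = p * (s + 1 + j) + i by rw [hk]; ring]
    have := natCast_choose_eq_lucas p (s + 1 + j) (s + 1) i 0 hi.2 hp.pos
    rwa [add_zero, Nat.choose_zero_right, Nat.cast_one, one_mul] at this
  have h27 : (27 : ZMod p) ^ i ≠ 0 := by
    rw [show (27 : ZMod p) = 3 ^ 3 by norm_num]
    exact pow_ne_zero i (pow_ne_zero 3 h3)
  rw [hchoose, deltaTerm, ← mul_div_assoc, eq_div_iff (mul_ne_zero hi0 h27)]
  push_cast
  rw [← hpow3, ← hneg]
  linear_combination (-1 : ZMod p) ^ k * 3 ^ (p * (s + 1) - 3 * k) * (s + 1 + j).choose (s + 1) *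
    trinomial j * trinomial i * 27 ^ i * he'

theorem sq_dvd_sum_deltaTerm_sub {p : ℕ} [Fact p.Prime] (hp3 : 3 < p) (n j : ℕ) :
    (p : ℤ) ^ 2 ∣ ∑ i ∈ Finset.range p, deltaTerm (p * n) (p * j + i) - deltaTerm n j := by
  have hp := Fact.out (p := p.Prime)
  rcases lt_or_ge n (3 * j) with h | h
  · rw [Finset.sum_eq_zero, deltaTerm_eq_zero h, sub_zero]
    · exact dvd_zero _
    · intro i _
      refine deltaTerm_eq_zero ?_
      have := Nat.mul_lt_mul_of_pos_left h hp.pos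
      linarith
  obtain ⟨q, hq, hq'⟩ := exists_three_pow_eq_sum_trinomial hp3
  obtain ⟨c, hc, hc'⟩ := exists_deltaTerm_mul_mul (by omega) hq n j
  choose! e he he' using fun i (hi : i ∈ Finset.Ico 1 p) => exists_deltaTerm_mul_add hp3 h hi
  rw [Finset.range_eq_Ico, Finset.sum_eq_sum_Ico_succ_bot hp.pos, zero_add, add_zero,
    Finset.sum_congr rfl he, ← Finset.mul_sum]
  have hdvd : (p : ℤ) ∣ c + ∑ i ∈ Finset.Ico 1 p, e i := by
    rw [← ZMod.intCast_zmod_eq_zero_iff_dvd]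
    refine (mul_eq_zero.1 (?_ : _ * (3 : ZMod p) = 0)).resolve_right (three_ne_zero_zmod hp3)
    push_cast
    rw [add_mul, hc', Finset.sum_mul, Finset.sum_congr rfl he', ← Finset.mul_sum,
      ← Finset.sum_filter, hq']
    ring
  obtain ⟨u, hu⟩ := hc
  obtain ⟨v, hv⟩ := hdvd
  exact ⟨u + v, by linear_combination hu + p * hv⟩

theorem sum_range_mul_eq {M : Type*} [AddCommMonoid M] (p m : ℕ) (f : ℕ → M) :
    ∑ k ∈ Finset.range (p * m), f k =
      ∑ j ∈ Finset.range m, ∑ i ∈ Finset.range p, f (p * j + i) := by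
  induction m with
  | zero => simp
  | succ m ih => rw [mul_add, mul_one, Finset.sum_range_add, ih, Finset.sum_range_succ]

theorem sq_dvd_deltaInt_mul_sub_of_three_lt {p : ℕ} [Fact p.Prime] (hp3 : 3 < p) (n : ℕ) :
    (p : ℤ) ^ 2 ∣ deltaInt (p * n) - deltaInt n := by
  have hp := Fact.out (p := p.Prime)
  rw [deltaInt_eq_sum (M := p * (n + 1)) (by nlinarith [hp.pos]),
    deltaInt_eq_sum (M := n + 1) (by omega), sum_range_mul_eq, ← Finset.sum_sub_distrib]
  exact Finset.dvd_sum fun j _ => sq_dvd_sum_deltaTerm_sub hp3 n j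

/-- The multinomial coefficient `(4n)! / n!⁴`. -/
def quadrinomial (n : ℕ) : ℕ := (4 * n).choose (3 * n) * trinomial n

theorem quadrinomial_mul_factorial (n : ℕ) :
    quadrinomial n * n.factorial ^ 4 = (4 * n).factorial := by
  have h := Nat.add_choose_mul_factorial_mul_factorial n (3 * n)
  rw [← trinomial_mul_factorial, show n + 3 * n = 4 * n by ring] at h
  rw [quadrinomial, ← h]
  ring

theorem quadrinomial_succ_mul (n : ℕ) :
    quadrinomial (n + 1) * (n + 1) ^ 3 =
      4 * (4 * n + 1) * (4 * n + 2) * (4 * n + 3) * quadrinomial n := by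
  have h := quadrinomial_mul_factorial (n + 1)
  rw [mul_add, mul_one, Nat.factorial_succ, Nat.factorial_succ, Nat.factorial_succ,
    Nat.factorial_succ, Nat.factorial_succ, ← quadrinomial_mul_factorial] at h
  have : (n + 1) * n.factorial ^ 4 ≠ 0 := by positivity
  apply mul_right_cancel₀ this
  linear_combination h

theorem nine_dvd_deltaInt_sub (n : ℕ) : (9 : ℤ) ∣ deltaInt n - deltaTerm n (n / 3) := by
  rw [deltaInt, Finset.sum_range_succ, add_sub_cancel_right]
  refine Finset.dvd_sum fun k hk => ?_
  rw [Finset.mem_range] at hk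
  have h : (9 : ℤ) ∣ 3 ^ (n - 3 * k) := pow_dvd_pow (3 : ℤ) (show 2 ≤ n - 3 * k by omega)
  rw [deltaTerm]
  exact (((h.mul_left _).mul_right _).mul_right _).mul_right _

theorem deltaTerm_three_mul (n : ℕ) : deltaTerm (3 * n) n = (-1) ^ n * quadrinomial n := by
  rw [deltaTerm, quadrinomial, Nat.sub_self, Nat.choose_self, show 3 * n + n = 4 * n by ring]
  push_cast
  ring

theorem deltaTerm_three_mul_add_one (m : ℕ) :
    deltaTerm (3 * m + 1) m = (-1) ^ m * 3 * (4 * m + 1) * quadrinomial m := by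
  have h := Nat.add_one_mul_choose_eq (4 * m) (3 * m)
  rw [deltaTerm, quadrinomial, Nat.add_sub_cancel_left, Nat.choose_succ_self_right,
    show 3 * m + 1 + m = 4 * m + 1 by ring]
  zify at h
  push_cast
  linear_combination -(-1) ^ m * 3 * trinomial m * h

theorem nine_dvd_deltaInt_three_mul_sub (n : ℕ) : (9 : ℤ) ∣ deltaInt (3 * n) - deltaInt n := by
  have h₁ := nine_dvd_deltaInt_sub (3 * n)
  have h₂ := nine_dvd_deltaInt_sub n
  rw [Nat.mul_div_cancel_left _ three_pos, deltaTerm_three_mul] at h₁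
  suffices h : (9 : ℤ) ∣ (-1) ^ n * quadrinomial n - deltaTerm n (n / 3) by
    have := dvd_sub (dvd_add h₁ h) h₂
    ring_nf at this ⊢
    exact this
  have h9 : (9 : ZMod 9) = 0 := rfl
  refine (ZMod.intCast_zmod_eq_zero_iff_dvd _ 9).1 ?_
  have hX (m : ℕ) : (quadrinomial (3 * m) : ZMod 9) = quadrinomial m := by
    have h₁ := choose_mul_mul_eq_choose Nat.prime_three (4 * m) (3 * m)
    have h₂ := trinomial_mul_eq Nat.prime_three m
    rw [quadrinomial, quadrinomial, Nat.cast_mul, Nat.cast_mul, mul_left_comm 4, ← h₂, ← h₁]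
  have hX₁ (m : ℕ) : (quadrinomial (3 * m + 1) : ZMod 9) = -3 * (4 * m + 1) * quadrinomial m := by
    have h := congrArg (Nat.cast : ℕ → ZMod 9) (quadrinomial_succ_mul (3 * m))
    push_cast at h
    rw [hX] at h
    linear_combination h + (3 * (4 * m + 1) * (64 * m ^ 2 + 16 * m + 1) * quadrinomial m -
      (3 * m ^ 3 + 3 * m ^ 2 + m) * quadrinomial (3 * m + 1) : ZMod 9) * h9
  obtain ⟨m, r, hr, rfl⟩ : ∃ m r, r < 3 ∧ n = 3 * m + r := ⟨n / 3, n % 3, by omega, by omega⟩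
  rw [show (3 * m + r) / 3 = m by omega]
  interval_cases r
  · rw [add_zero, deltaTerm_three_mul]
    push_cast
    rw [hX, pow_mul]
    norm_num
  · rw [deltaTerm_three_mul_add_one]
    push_cast
    rw [hX₁, pow_succ, pow_mul]
    norm_num
    ring
  · have h := congrArg (Nat.cast : ℕ → ZMod 9) (quadrinomial_succ_mul (3 * m + 1))
    have hT : (deltaTerm (3 * m + 2) m : ZMod 9) = 0 := by
      rw [deltaTerm, Nat.add_sub_cancel_left]
      push_cast
      linear_combination ((-1) ^ m * (3 * m + 2).choose (3 * m) * (3 * m + 2 + m).choose (3 * m + 2) *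
        trinomial m : ZMod 9) * h9
    have hX₂ : (quadrinomial (3 * m + 2) : ZMod 9) = 0 := by
      push_cast at h
      rw [hX₁] at h
      linear_combination -h + ((1 + 3 * m ^ 3 + 6 * m ^ 2 + 4 * m) * quadrinomial (3 * m + 2) +
        8 * (12 * m + 5) * (2 * m + 1) * (12 * m + 7) * (4 * m + 1) * quadrinomial m : ZMod 9) * h9
    push_cast
    rw [hT, hX₂]
    ring

theorem sq_dvd_deltaInt_mul_sub {p : ℕ} (hp : p.Prime) (hp3 : 3 ≤ p) (n : ℕ) :
    (p : ℤ) ^ 2 ∣ deltaInt (p * n) - deltaInt n := by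
  rcases hp3.eq_or_lt with rfl | hp3
  · exact nine_dvd_deltaInt_three_mul_sub n
  · have := Fact.mk hp
    exact sq_dvd_deltaInt_mul_sub_of_three_lt hp3 n

theorem aperyDelta_recurrence (n : ℕ) :
    ((n : ℚ) + 1) ^ 3 * aperyDelta (n + 1) =
      (2 * n + 1) * (7 * n ^ 2 + 7 * n + 3) * aperyDelta n - 81 * n ^ 3 * aperyDelta (n - 1) := by
  simp only [aperyDelta_eq_deltaInt]
  exact_mod_cast deltaInt_recurrence n

/-- The subring of `p`-integral rational numbers. -/
def pIntegral (p : ℕ) [Fact p.Prime] : Subring ℚ where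
  carrier := {x | padicNorm p x ≤ 1}
  mul_mem' ha hb := by
    rw [Set.mem_ofPred_eq, padicNorm.mul]
    exact mul_le_one₀ ha (padicNorm.nonneg _) hb
  one_mem' := padicNorm.one.le
  add_mem' ha hb := padicNorm.nonarchimedean.trans (max_le ha hb)
  zero_mem' := by
    rw [Set.mem_ofPred_eq, padicNorm.zero]
    exact zero_le_one
  neg_mem' ha := by
    rwa [Set.mem_ofPred_eq, padicNorm.neg]

theorem mem_pIntegral_of_natCast_pow_mul_mem {p : ℕ} [Fact p.Prime] {a : ℕ} (ha : ¬p ∣ a) (e : ℕ)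
    {x : ℚ} (h : (a : ℚ) ^ e * x ∈ pIntegral p) : x ∈ pIntegral p := by
  have h' : padicNorm p ((a : ℚ) ^ e * x) ≤ 1 := h
  have hae : ¬p ∣ a ^ e := fun hd => ha ((Fact.out (p := p.Prime)).dvd_of_dvd_pow hd)
  rw [padicNorm.mul, ← Nat.cast_pow, (padicNorm.nat_eq_one_iff _).2 hae, one_mul] at h'
  exact h'

theorem aperyDelta_mem_pIntegral (p : ℕ) [Fact p.Prime] (n : ℕ) : aperyDelta n ∈ pIntegral p := by
  rw [aperyDelta_eq_deltaInt]
  exact intCast_mem _ _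

theorem sq_mul_eq_zero_or_two_le_padicValRat {p : ℕ} [Fact p.Prime] {y : ℚ} (hy : y ∈ pIntegral p) :
    (p : ℚ) ^ 2 * y = 0 ∨ 2 ≤ padicValRat p ((p : ℚ) ^ 2 * y) := by
  have hp := Fact.out (p := p.Prime)
  rcases eq_or_ne y 0 with rfl | h0
  · exact Or.inl (mul_zero _)
  right
  have hp0 : (p : ℚ) ≠ 0 := by exact_mod_cast hp.ne_zero
  have hp1 : (1 : ℚ) < p := by exact_mod_cast hp.one_lt
  have hy' : padicNorm p y ≤ 1 := hy
  rw [padicNorm.eq_zpow_of_nonzero h0, zpow_le_one_iff_right₀ hp1] at hy'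
  rw [padicValRat.mul (pow_ne_zero 2 hp0) h0, padicValRat.pow, padicValRat.self hp.one_lt]
  push_cast
  linarith

/-- `D` satisfies the formal derivative of the recurrence of the Almkvist–Zudilin numbers. -/
structure IsFormalDerivative (D : ℕ → ℚ) : Prop where
  zero : D 0 = 0
  recurrence (n : ℕ) : ((n : ℚ) + 1) ^ 3 * D (n + 1) =
    (2 * (n : ℚ) + 1) * (7 * (n : ℚ) ^ 2 + 7 * n + 3) * D n - 81 * (n : ℚ) ^ 3 * D (n - 1)
      - 3 * ((n : ℚ) + 1) ^ 2 * aperyDelta (n + 1)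
      + (42 * (n : ℚ) ^ 2 + 42 * n + 13) * aperyDelta n
      - 243 * (n : ℚ) ^ 2 * aperyDelta (n - 1)

theorem IsFormalDerivative.mem_pIntegral {D : ℕ → ℚ} (hD : IsFormalDerivative D) {p : ℕ}
    [Fact p.Prime] {k : ℕ} (hk : k < p) : D k ∈ pIntegral p := by
  induction k using Nat.strong_induction_on with
  | _ k ih =>
    rcases k with _ | k
    · rw [hD.zero]
      exact zero_mem _
    refine mem_pIntegral_of_natCast_pow_mul_mem (Nat.not_dvd_of_pos_of_lt k.succ_pos hk) 3 ?_
    have hA := aperyDelta_mem_pIntegral p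
    have hn := natCast_mem (pIntegral p)
    have h₁ := ih k (by omega) (by omega)
    have h₂ := ih (k - 1) (by omega) (by omega)
    push_cast
    rw [hD.recurrence k]
    simp (maxDischargeDepth := 20) only [add_mem, sub_mem, mul_mem, pow_mem, one_mem, ofNat_mem, hA, hn, h₁, h₂]

theorem IsFormalDerivative.exists_aperyDelta_mul_add_eq {D : ℕ → ℚ} (hD : IsFormalDerivative D)
    {p : ℕ} [Fact p.Prime] (hp3 : 3 ≤ p) (n : ℕ) {k : ℕ} (hk : k < p) :
    ∃ y ∈ pIntegral p, aperyDelta (p * n + k) - aperyDelta k * aperyDelta n -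
      p * n * D k * aperyDelta n = p ^ 2 * y := by
  have hp := Fact.out (p := p.Prime)
  have hA := aperyDelta_mem_pIntegral p
  have hn := natCast_mem (pIntegral p)
  have hp0 : (p : ℚ) ≠ 0 := by exact_mod_cast hp.ne_zero
  induction k using Nat.strong_induction_on with
  | _ k ih =>
    rcases k with _ | k
    · obtain ⟨y, hy⟩ := sq_dvd_deltaInt_mul_sub hp hp3 n
      refine ⟨y, intCast_mem _ _, ?_⟩
      rw [add_zero, hD.zero, show aperyDelta 0 = 1 by simp [aperyDelta], aperyDelta_eq_deltaInt,
        aperyDelta_eq_deltaInt, one_mul, mul_zero, zero_mul, sub_zero]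
      exact_mod_cast hy
    obtain ⟨y₁, hy₁, h₁⟩ := ih k (by omega) (by omega)
    have hDk := hD.mem_pIntegral (show k < p by omega)
    have hDk' := hD.mem_pIntegral hk
    obtain ⟨y₂, hy₂, h₂⟩ : ∃ y ∈ pIntegral p,
        ((p : ℚ) * n + k) ^ 3 * aperyDelta (p * n + k - 1) - aperyDelta n *
          (k ^ 3 * aperyDelta (k - 1) +
            p * n * (3 * k ^ 2 * aperyDelta (k - 1) + k ^ 3 * D (k - 1))) = p ^ 2 * y := by
      rcases k with _ | l
      · refine ⟨p * n ^ 3 * aperyDelta (p * n - 1), ?_, ?_⟩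
        · simp (maxDischargeDepth := 20) only [mul_mem, pow_mem, hA, hn]
        · simp only [Nat.cast_zero, add_zero]
          ring
      · obtain ⟨y, hy, h⟩ := ih l (by omega) (by omega)
        have hDl := hD.mem_pIntegral (show l < p by omega)
        refine ⟨(p * n + (l + 1 : ℕ)) ^ 3 * y + n ^ 2 * aperyDelta n *
          ((3 * (l + 1 : ℕ) + p * n) * aperyDelta l + (3 * (l + 1 : ℕ) ^ 2 +
            3 * (l + 1 : ℕ) * (p * n) + (p * n) ^ 2) * D l), ?_, ?_⟩
        · simp (maxDischargeDepth := 20) only [add_mem, mul_mem, pow_mem, ofNat_mem, hA, hn, hy, hDl]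
        · rw [← add_assoc, Nat.add_sub_cancel, Nat.add_sub_cancel]
          linear_combination (p * n + (l + 1 : ℕ) : ℚ) ^ 3 * h
    have hdvd : ¬p ∣ p * n + (k + 1) := fun h =>
      Nat.not_dvd_of_pos_of_lt k.succ_pos hk ((Nat.dvd_add_right (dvd_mul_right p n)).1 h)
    refine ⟨(aperyDelta (p * n + (k + 1)) - aperyDelta (k + 1) * aperyDelta n -
      p * n * D (k + 1) * aperyDelta n) / p ^ 2, ?_, by field_simp⟩
    refine mem_pIntegral_of_natCast_pow_mul_mem hdvd 3 ?_
    have hw : ((p * n + (k + 1) : ℕ) : ℚ) ^ 3 *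
        ((aperyDelta (p * n + (k + 1)) - aperyDelta (k + 1) * aperyDelta n -
          p * n * D (k + 1) * aperyDelta n) / p ^ 2) =
        (2 * (p * n + k) + 1) * (7 * (p * n + k) ^ 2 + 7 * (p * n + k) + 3) * y₁ - 81 * y₂ +
        n ^ 2 * aperyDelta n * ((42 * k + 21 + 14 * (p * n)) * aperyDelta k +
          (42 * k ^ 2 + 42 * k + 13 + p * n * (42 * k + 21) + 14 * (p * n) ^ 2) * D k -
          (3 * (k + 1) + p * n) * aperyDelta (k + 1) -
          (3 * (k + 1) ^ 2 + 3 * (k + 1) * (p * n) + (p * n) ^ 2) * D (k + 1)) := by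
      rw [← mul_div_assoc, div_eq_iff (pow_ne_zero 2 hp0)]
      have e₁ := aperyDelta_recurrence (p * n + k)
      have e₂ := aperyDelta_recurrence k
      have e₃ := hD.recurrence k
      push_cast at e₁ ⊢
      rw [← add_assoc]
      linear_combination e₁ - (1 : ℚ) * aperyDelta n * e₂ - p * n * aperyDelta n * e₃ +
        (2 * (p * n + k) + 1) * (7 * (p * n + k) ^ 2 + 7 * (p * n + k) + 3 : ℚ) * h₁ - 81 * h₂
    rw [hw]
    simp (maxDischargeDepth := 20) only [add_mem, sub_mem, mul_mem, pow_mem, one_mem, ofNat_mem, hA, hn, hy₁, hy₂, hDk, hDk']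

theorem gessel_lucas_delta (D : ℕ → ℚ) (hD0 : D 0 = 0)
    (hD1 : D 1 = 3 * D 0 - 3 * aperyDelta 1 + 13 * aperyDelta 0)
    (hrec : ∀ n : ℕ, 1 ≤ n →
      ((n : ℚ) + 1) ^ 3 * D (n + 1) =
        (2 * (n : ℚ) + 1) * (7 * (n : ℚ) ^ 2 + 7 * n + 3) * D n
          - 81 * (n : ℚ) ^ 3 * D (n - 1)
          - 3 * ((n : ℚ) + 1) ^ 2 * aperyDelta (n + 1)
          + (42 * (n : ℚ) ^ 2 + 42 * n + 13) * aperyDelta n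
          - 243 * (n : ℚ) ^ 2 * aperyDelta (n - 1))
    (p : ℕ) (hp : p.Prime) (hp3 : 3 ≤ p) (n k : ℕ) (hk : k < p) :
    aperyDelta (p * n + k) - aperyDelta k * aperyDelta n
        - p * n * D k * aperyDelta n = 0 ∨
      2 ≤ padicValRat p
        (aperyDelta (p * n + k) - aperyDelta k * aperyDelta n
          - p * n * D k * aperyDelta n) := by
  have := Fact.mk hp
  have hD : IsFormalDerivative D := by
    refine ⟨hD0, fun m => ?_⟩
    rcases m.eq_zero_or_pos with rfl | hm
    · norm_num
      linarith
    · exact hrec m hm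
  obtain ⟨y, hy, h⟩ := hD.exists_aperyDelta_mul_add_eq hp3 n hk
  rw [h]
  exact sq_mul_eq_zero_or_two_le_padicValRat hy
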